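/- arXiv:0902.0543 — 5 statements merged into one kernel-verified Lean document; each statement's English description precedes it below -/
import Mathlib

section
/- Let A, B, C be finite-dimensional complex vector spaces and let T ∈ A⊗B⊗C admit an expression T = ∑_{i=1}^r u_i⊗v_i⊗w_i with u_i ∈ A, v_i ∈ B, w_i ∈ C. Let k_A, k_B, k_C denote the Kruskal ranks of the families (u_i), (v_i), (w_i) respectively. If r ≤ (k_A + k_B + k_C)/2 − 1 (equivalently 2r ≤ k_A + k_B + k_C − 2), then the tensor rank of T equals r. -/
open TensorProduct

/-- Kruskal rank: the largest `k` such that every `k`-element subfamily is linearly independent. -/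
noncomputable def kruskalRank {V : Type*} [AddCommGroup V] [Module ℂ V]
    {r : ℕ} (u : Fin r → V) : ℕ :=
  sSup {k | k ≤ r ∧ ∀ s : Finset (Fin r), s.card = k →
    LinearIndependent ℂ (fun i : {x // x ∈ s} => u i)}

/-- Tensor rank in a three-factor tensor product: the smallest `m` such that the tensor is
a sum of `m` simple tensors. -/
noncomputable def tensorRank3 {A B C : Type*} [AddCommGroup A] [Module ℂ A]
    [AddCommGroup B] [Module ℂ B] [AddCommGroup C] [Module ℂ C]
    (T : (A ⊗[ℂ] B) ⊗[ℂ] C) : ℕ :=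
  sInf {m | ∃ (a : Fin m → A) (b : Fin m → B) (c : Fin m → C),
    T = ∑ i, (a i ⊗ₜ[ℂ] b i) ⊗ₜ[ℂ] c i}

section LinearAlgebra

open Module Submodule

variable {K A B C : Type*} [Field K] [AddCommGroup A] [Module K A] [AddCommGroup B] [Module K B]
  [AddCommGroup C] [Module K C]

lemma sup_span_singleton_eq {F : Submodule K C} {x y : C} (hx : x ∉ F)
    (hxy : x ∈ F ⊔ K ∙ y) : F ⊔ K ∙ x = F ⊔ K ∙ y := by
  obtain ⟨f, hf, z, hz, rfl⟩ := mem_sup.1 hxy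
  obtain ⟨a, rfl⟩ := mem_span_singleton.1 hz
  have ha : a ≠ 0 := by
    rintro rfl
    exact hx (by simpa using hf)
  refine le_antisymm (sup_le le_sup_left ?_) (sup_le le_sup_left ?_)
  · simpa using hxy
  · rw [span_singleton_le_iff_mem]
    have h : f + a • y ∈ F ⊔ K ∙ (f + a • y) := mem_sup_right (mem_span_singleton_self _)
    have h' : a • y ∈ F ⊔ K ∙ (f + a • y) := by
      simpa using sub_mem h (mem_sup_left hf)
    exact (smul_mem_iff _ ha).1 h'

/-- If `∑ uᵢ ⊗ vᵢ = 0`, then the relations among the `vᵢ` contain the row space of the `uᵢ`. -/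
lemma finrank_span_add_finrank_span_le [FiniteDimensional K A] {ι : Type*} [Fintype ι]
    (u : ι → A) (v : ι → B) (h : ∑ i, u i ⊗ₜ[K] v i = 0) :
    finrank K (span K (Set.range u)) + finrank K (span K (Set.range v)) ≤ Fintype.card ι := by
  classical
  set P := Fintype.linearCombination K u
  set Q := Fintype.linearCombination K v
  set E := (Pi.basisFun K ι).constr (M' := K) K
  have hle : (LinearMap.range P.dualMap).map E.symm.toLinearMap ≤ LinearMap.ker Q := by
    rintro _ ⟨_, ⟨ψ, rfl⟩, rfl⟩
    have hψ := congrArg ((TensorProduct.lid K B).toLinearMap ∘ₗ ψ.rTensor B) h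
    simp only [map_sum, LinearMap.comp_apply, LinearMap.rTensor_tmul, LinearEquiv.coe_coe,
      TensorProduct.lid_tmul, map_zero] at hψ
    rw [LinearMap.mem_ker, ← hψ]
    simp [Q, P, E, Fintype.linearCombination_apply, Module.Basis.constr]
  have h₁ : finrank K ((LinearMap.range P.dualMap).map E.symm.toLinearMap) =
      finrank K (span K (Set.range u)) := by
    rw [LinearEquiv.finrank_map_eq, LinearMap.finrank_range_dualMap_eq_finrank_range,
      Fintype.range_linearCombination]
  have h₂ := Q.finrank_range_add_finrank_ker
  rw [Fintype.range_linearCombination, finrank_fintype_fun_eq_card] at h₂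
  have := finrank_mono hle
  omega

open Classical in
lemma card_mem_eq_add_card_sup_eq {ι : Type*} [Fintype ι] (x : ι → C) {F G : Submodule K C}
    (hG : ∃ y, y ∉ F ∧ F ⊔ K ∙ y = G) :
    Fintype.card {i // x i ∈ G} = Fintype.card {i // x i ∈ F} +
      ((Finset.univ.filter fun i => x i ∉ F).filter fun i => F ⊔ K ∙ x i = G).card := by
  obtain ⟨y, hy, rfl⟩ := hG
  rw [Fintype.card_subtype, Fintype.card_subtype, ← Finset.card_union_of_disjoint]
  · congr 1
    ext i
    simp only [Finset.mem_filter, Finset.mem_univ, true_and, Finset.mem_union]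
    constructor
    · intro hi
      by_cases hiF : x i ∈ F
      · exact Or.inl hiF
      · exact Or.inr ⟨hiF, sup_span_singleton_eq hiF hi⟩
    · rintro (hi | ⟨-, hi⟩)
      · exact mem_sup_left hi
      · exact hi ▸ mem_sup_right (mem_span_singleton_self _)
  · rw [Finset.disjoint_left]
    intro i hi hi'
    simp only [Finset.mem_filter, Finset.mem_univ, true_and] at hi hi'
    exact hi'.1 hi

open Classical in
lemma card_mem_add_card_notMem {ι : Type*} [Fintype ι] (x : ι → C) (F : Submodule K C) :
    Fintype.card {i // x i ∈ F} + (Finset.univ.filter fun i => x i ∉ F).card =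
      Fintype.card ι := by
  rw [Fintype.card_subtype, Finset.card_filter_add_card_filter_not, Finset.card_univ]

open Classical in
/-- A form of Kruskal's permutation lemma: if the inequality `#{c ∈ H} + #w ≤ #{w ∈ H} + #c` holds
for every hyperplane `H` of `span c` spanned by members of `c`, then it holds for every subspace
spanned by members of `c`. -/
lemma card_mem_add_card_le_of_hyperplanes [FiniteDimensional K C] {ι κ : Type*} [Fintype ι]
    [Fintype κ] (w : ι → C) (c : κ → C) (hwc : ∀ i, w i ∈ span K (Set.range c))
    (hyp : ∀ φ : Dual K C,
      finrank K (span K (Set.range c)) ≤ Fintype.card {j // φ (c j) = 0} + 1 →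
      Fintype.card {j // φ (c j) = 0} + Fintype.card ι ≤
        Fintype.card {i // φ (w i) = 0} + Fintype.card κ) (J : Set κ) :
    Fintype.card {j // c j ∈ span K (c '' J)} + Fintype.card ι ≤
      Fintype.card {i // w i ∈ span K (c '' J)} + Fintype.card κ := by
  suffices H : ∀ F : Submodule K C, ∀ J : Set κ, F = span K (c '' J) →
      Fintype.card {j // c j ∈ F} + Fintype.card ι ≤
        Fintype.card {i // w i ∈ F} + Fintype.card κ from H _ J rfl
  intro F
  induction F using WellFoundedGT.induction with
  | ind F ih =>
  intro J hF
  set P : Finset (Submodule K C) :=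
    ((Finset.univ.filter fun j => c j ∉ F).image fun j => F ⊔ K ∙ c j) with hP
  have memP : ∀ G ∈ P, ∃ j, c j ∉ F ∧ F ⊔ K ∙ c j = G := by
    intro G hG
    simpa [hP] using hG
  rcases Nat.lt_or_ge 1 P.card with hp | hp
  · have hG : ∀ G ∈ P, Fintype.card {j // c j ∈ G} + Fintype.card ι ≤
        Fintype.card {i // w i ∈ G} + Fintype.card κ := by
      intro G hG
      obtain ⟨j, hj, rfl⟩ := memP G hG
      refine ih _ (lt_of_le_of_ne le_sup_left fun h => hj ?_) (insert j J) ?_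
      · rw [h]
        exact mem_sup_right (mem_span_singleton_self _)
      · rw [Set.image_insert_eq, span_insert, ← hF, sup_comm]
    have hsum := Finset.sum_le_sum hG
    have hPy : ∀ G ∈ P, ∃ y, y ∉ F ∧ F ⊔ K ∙ y = G := fun G hG =>
      let ⟨j, hj⟩ := memP G hG
      ⟨c j, hj⟩
    rw [Finset.sum_add_distrib, Finset.sum_add_distrib,
      Finset.sum_congr rfl fun G hG => card_mem_eq_add_card_sup_eq c (hPy G hG),
      Finset.sum_congr rfl fun G hG => card_mem_eq_add_card_sup_eq w (hPy G hG)] at hsum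
    simp only [Finset.sum_add_distrib, Finset.sum_const, smul_eq_mul] at hsum
    have hc : (Finset.univ.filter fun j => c j ∉ F).card = ∑ G ∈ P,
        ((Finset.univ.filter fun j => c j ∉ F).filter fun j => F ⊔ K ∙ c j = G).card :=
      Finset.card_eq_sum_card_image _ _
    have hw : ∑ G ∈ P, ((Finset.univ.filter fun i => w i ∉ F).filter
        fun i => F ⊔ K ∙ w i = G).card ≤ (Finset.univ.filter fun i => w i ∉ F).card := by
      rw [Finset.sum_card_fiberwise_eq_card_filter]
      exact Finset.card_filter_le _ _
    rw [← hc] at hsum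
    have h₁ := card_mem_add_card_notMem c F
    have h₂ := card_mem_add_card_notMem w F
    obtain ⟨q, hq⟩ := Nat.exists_eq_add_of_lt hp
    rw [hq] at hsum
    by_contra! hlt
    nlinarith
  · rcases Classical.em (∃ j, c j ∉ F) with ⟨j₀, hj₀⟩ | hall
    · have hcG : ∀ j, c j ∈ F ⊔ K ∙ c j₀ := by
        intro j
        by_cases hj : c j ∈ F
        · exact mem_sup_left hj
        · have : F ⊔ K ∙ c j = F ⊔ K ∙ c j₀ :=
            Finset.card_le_one.1 hp _ (by rw [hP]; exact Finset.mem_image_of_mem _ (by simpa))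
              _ (by rw [hP]; exact Finset.mem_image_of_mem _ (by simpa))
          exact this ▸ mem_sup_right (mem_span_singleton_self _)
      have hG : span K (Set.range c) ≤ F ⊔ K ∙ c j₀ :=
        span_le.2 (Set.range_subset_iff.2 hcG)
      obtain ⟨φ, hφ, hFφ⟩ := exists_le_ker_of_notMem hj₀
      have key : ∀ x ∈ span K (Set.range c), x ∈ F ↔ φ x = 0 := by
        intro x hx
        refine ⟨fun h => hFφ h, fun h => ?_⟩
        by_contra hxF
        have h' : c j₀ ∈ F ⊔ K ∙ x := by
          rw [sup_span_singleton_eq hxF (hG hx)]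
          exact mem_sup_right (mem_span_singleton_self _)
        exact hφ ((sup_le hFφ (by simpa [span_singleton_le_iff_mem] using h) : F ⊔ K ∙ x ≤ LinearMap.ker φ) h')
      have hc : ∀ j, c j ∈ F ↔ φ (c j) = 0 := fun j => key _ (subset_span ⟨j, rfl⟩)
      have hw : ∀ i, w i ∈ F ↔ φ (w i) = 0 := fun i => key _ (hwc i)
      simp only [hc, hw]
      apply hyp
      have h₁ : finrank K F ≤ Fintype.card {j // φ (c j) = 0} := by
        have hle : F ≤ span K (Set.range fun j : {j // φ (c j) = 0} => c j) := by
          conv_lhs => rw [hF]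
          refine span_mono ?_
          rintro _ ⟨j, hj, rfl⟩
          exact ⟨⟨j, (hc j).1 (hF ▸ subset_span ⟨j, hj, rfl⟩)⟩, rfl⟩
        exact (finrank_mono hle).trans (finrank_range_le_card _)
      have h₂ := finrank_add_le_finrank_add_finrank F (K ∙ c j₀)
      have h₃ := finrank_mono hG
      have h₄ : finrank K (K ∙ c j₀) ≤ 1 := by
        simpa using finrank_span_le_card (R := K) {c j₀}
      omega
    · push Not at hall
      have hw : ∀ i, w i ∈ F := fun i =>
        (span_le.2 (Set.range_subset_iff.2 hall) : span K (Set.range c) ≤ F) (hwc i)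
      simp [hall, hw, Fintype.card_subtype, add_comm]

end LinearAlgebra

section KruskalRank

variable {V : Type*} [AddCommGroup V] [Module ℂ V] {r : ℕ} (u : Fin r → V)

lemma kruskalRank_mem : kruskalRank u ∈ {k | k ≤ r ∧ ∀ s : Finset (Fin r), s.card = k →
    LinearIndependent ℂ (fun i : {x // x ∈ s} => u i)} := by
  refine Nat.sSup_mem ⟨0, Nat.zero_le _, fun s hs => ?_⟩ ⟨r, fun k hk => hk.1⟩
  obtain rfl := Finset.card_eq_zero.1 hs
  exact linearIndependent_empty_type

lemma kruskalRank_le : kruskalRank u ≤ r := (kruskalRank_mem u).1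

lemma linearIndependent_of_card_le_kruskalRank {s : Finset (Fin r)}
    (hs : s.card ≤ kruskalRank u) : LinearIndependent ℂ (fun i : {x // x ∈ s} => u i) := by
  obtain ⟨t, hst, ht⟩ := Finset.exists_superset_card_eq hs (by simpa using kruskalRank_le u)
  exact ((kruskalRank_mem u).2 t ht).comp (fun i : {x // x ∈ s} => ⟨i.1, hst i.2⟩)
    fun i j h => Subtype.ext (congrArg (fun x : {x // x ∈ t} => x.1) h)

lemma min_card_kruskalRank_le_finrank [FiniteDimensional ℂ V] (s : Finset (Fin r))
    (W : Submodule ℂ V) (hW : ∀ i ∈ s, u i ∈ W) :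
    min s.card (kruskalRank u) ≤ Module.finrank ℂ W := by
  obtain ⟨t, hts, ht⟩ := Finset.exists_subset_card_eq (min_le_left s.card (kruskalRank u))
  have hli := linearIndependent_of_card_le_kruskalRank u (ht.trans_le (min_le_right _ _))
  have h := finrank_span_eq_card hli
  rw [Fintype.card_coe, ht] at h
  rw [← h]
  refine Submodule.finrank_mono (Submodule.span_le.2 ?_)
  rintro _ ⟨i, rfl⟩
  exact hW _ (hts i.2)

end KruskalRank

section Kruskal

variable {A B C : Type*} [AddCommGroup A] [Module ℂ A] [AddCommGroup B] [Module ℂ B]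
  [AddCommGroup C] [Module ℂ C] [FiniteDimensional ℂ A] [FiniteDimensional ℂ B]

open Classical in
/-- Contracting two decompositions of one tensor with a linear form `φ`, and comparing the ranks of
the resulting elements of `A ⊗ B`. -/
lemma min_add_min_le_of_sum_tmul_eq {r m : ℕ} {u : Fin r → A} {v : Fin r → B} {w : Fin r → C}
    {a : Fin m → A} {b : Fin m → B} {c : Fin m → C}
    (h : ∑ i, (u i ⊗ₜ[ℂ] v i) ⊗ₜ[ℂ] w i = ∑ j, (a j ⊗ₜ[ℂ] b j) ⊗ₜ[ℂ] c j)
    (φ : Module.Dual ℂ C) :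
    min (Fintype.card {i // φ (w i) ≠ 0}) (kruskalRank u) +
      min (Fintype.card {i // φ (w i) ≠ 0}) (kruskalRank v) ≤
      Fintype.card {i // φ (w i) ≠ 0} + Fintype.card {j // φ (c j) ≠ 0} := by
  have hφ := congrArg ((TensorProduct.rid ℂ (A ⊗[ℂ] B)).toLinearMap ∘ₗ φ.lTensor (A ⊗[ℂ] B)) h
  simp only [map_sum, LinearMap.comp_apply, LinearMap.lTensor_tmul, LinearEquiv.coe_coe,
    TensorProduct.rid_tmul] at hφ
  have restrict : ∀ {n : ℕ} (x : Fin n → C) (y : Fin n → A ⊗[ℂ] B),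
      ∑ i : {i // φ (x i) ≠ 0}, φ (x i) • y i = ∑ i, φ (x i) • y i := by
    intro n x y
    rw [← Finset.sum_subtype (Finset.univ.filter fun i => φ (x i) ≠ 0) (by simp)
      fun i => φ (x i) • y i]
    exact Finset.sum_filter_of_ne fun i _ h hi => h (by rw [hi, zero_smul])
  rw [← restrict, ← restrict] at hφ
  let u' : {i // φ (w i) ≠ 0} ⊕ {j // φ (c j) ≠ 0} → A :=
    Sum.elim (fun i => φ (w i) • u i) (fun j => -(φ (c j) • a j))
  let v' : {i // φ (w i) ≠ 0} ⊕ {j // φ (c j) ≠ 0} → B := Sum.elim (fun i => v i) (fun j => b j)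
  have hzero : ∑ i, u' i ⊗ₜ[ℂ] v' i = 0 := by
    rw [Fintype.sum_sum_type]
    simp [u', v', TensorProduct.neg_tmul, ← TensorProduct.smul_tmul', hφ]
  have hrank := finrank_span_add_finrank_span_le u' v' hzero
  have hu := min_card_kruskalRank_le_finrank u (Finset.univ.filter fun i => φ (w i) ≠ 0)
    (Submodule.span ℂ (Set.range u')) fun i hi => by
      have hi' : φ (w i) ≠ 0 := by simpa using hi
      exact (Submodule.smul_mem_iff _ hi').1 (Submodule.subset_span ⟨Sum.inl ⟨i, hi'⟩, rfl⟩)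
  have hv := min_card_kruskalRank_le_finrank v (Finset.univ.filter fun i => φ (w i) ≠ 0)
    (Submodule.span ℂ (Set.range v')) fun i hi =>
      Submodule.subset_span ⟨Sum.inl ⟨i, by simpa using hi⟩, rfl⟩
  rw [Fintype.card_sum] at hrank
  rw [← Fintype.card_subtype] at hu hv
  omega

end Kruskal

/-- Kruskal's theorem, rank statement: if `T = ∑ uᵢ ⊗ vᵢ ⊗ wᵢ` with `r` terms and
`2r ≤ k_A + k_B + k_C − 2`, then the tensor rank of `T` is exactly `r`. -/
theorem kruskal_rank_eq {A B C : Type*} [AddCommGroup A] [Module ℂ A]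
    [AddCommGroup B] [Module ℂ B] [AddCommGroup C] [Module ℂ C]
    [FiniteDimensional ℂ A] [FiniteDimensional ℂ B] [FiniteDimensional ℂ C]
    {r : ℕ} (u : Fin r → A) (v : Fin r → B) (w : Fin r → C)
    (T : (A ⊗[ℂ] B) ⊗[ℂ] C)
    (hT : T = ∑ i, (u i ⊗ₜ[ℂ] v i) ⊗ₜ[ℂ] w i)
    (hk : 2 * r + 2 ≤ kruskalRank u + kruskalRank v + kruskalRank w) :
    tensorRank3 T = r := by
  classical
  refine le_antisymm (Nat.sInf_le ⟨u, v, w, hT⟩) (le_csInf ⟨r, u, v, w, hT⟩ ?_)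
  rintro m ⟨a, b, c, hT'⟩
  by_contra! hmr
  have hcontr := min_add_min_le_of_sum_tmul_eq (hT.symm.trans hT')
  have hu := kruskalRank_le u
  have hv := kruskalRank_le v
  have hw := kruskalRank_le w
  have hsplit : ∀ {n : ℕ} (x : Fin n → C) (φ : Module.Dual ℂ C),
      Fintype.card {i // φ (x i) = 0} + Fintype.card {i // φ (x i) ≠ 0} = n := by
    intro n x φ
    rw [Fintype.card_subtype, Fintype.card_subtype, Finset.card_filter_add_card_filter_not,
      Finset.card_univ, Fintype.card_fin]
  have hspan : ∀ i, w i ∈ Submodule.span ℂ (Set.range c) := by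
    intro i
    by_contra hi
    obtain ⟨φ, hφ, hker⟩ := Submodule.exists_le_ker_of_notMem hi
    have hs : 0 < Fintype.card {i // φ (w i) ≠ 0} := Fintype.card_pos_iff.2 ⟨⟨i, hφ⟩⟩
    have ht : Fintype.card {j // φ (c j) ≠ 0} = 0 :=
      Fintype.card_eq_zero_iff.2 ⟨fun j => j.2 (hker (Submodule.subset_span ⟨j, rfl⟩))⟩
    have h₁ := hcontr φ
    have h₂ := hsplit w φ
    omega
  have hdim : kruskalRank w ≤ Module.finrank ℂ (Submodule.span ℂ (Set.range c)) := by
    simpa [hw] using min_card_kruskalRank_le_finrank w Finset.univ _ fun i _ => hspan i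
  have hflat := card_mem_add_card_le_of_hyperplanes w c hspan (fun φ hφ => by
    have h₁ := hcontr φ
    have h₂ := hsplit w φ
    have h₃ := hsplit c φ
    simp only [Fintype.card_fin]
    omega) ∅
  simp only [Set.image_empty, Submodule.span_empty, Submodule.mem_bot, Fintype.card_fin] at hflat
  have hpos : 0 < Fintype.card {i // w i = 0} := by omega
  obtain ⟨⟨i, hi⟩⟩ := Fintype.card_pos_iff.1 hpos
  have hli := linearIndependent_of_card_le_kruskalRank w (s := {i}) (by
    rw [Finset.card_singleton]
    omega)
  exact hli.ne_zero ⟨i, Finset.mem_singleton_self i⟩ hi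
end

section
/- Let A, B, C be finite-dimensional complex vector spaces and let T ∈ A⊗B⊗C admit an expression T = ∑_{i=1}^r u_i⊗v_i⊗w_i with u_i ∈ A, v_i ∈ B, w_i ∈ C. Let k_A, k_B, k_C denote the Kruskal ranks of the families (u_i), (v_i), (w_i). If 2r ≤ k_A + k_B + k_C − 2, then the rank-r expression is essentially unique: for any other expression T = ∑_{i=1}^r ũ_i⊗ṽ_i⊗w̃_i there exist a permutation σ of {1, ..., r} and nonzero complex scalars λ_i, μ_i, ν_i with λ_i μ_i ν_i = 1 such that ũ_i = λ_i u_{σ(i)}, ṽ_i = μ_i v_{σ(i)}, w̃_i = ν_i w_{σ(i)} for all i. -/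
open TensorProduct

/-- Every subfamily of `u` with at most `k` members is linearly independent. -/
def KruskalIndep (K : Type*) {ι V : Type*} [Field K] [AddCommGroup V] [Module K V]
    (k : ℕ) (u : ι → V) : Prop :=
  ∀ s : Finset ι, s.card ≤ k → LinearIndepOn K u s

section Field

variable {K ι V A B C : Type*} [Field K]
  [AddCommGroup V] [Module K V] [AddCommGroup A] [Module K A]
  [AddCommGroup B] [Module K B] [AddCommGroup C] [Module K C]

lemma KruskalIndep.ne_zero {k : ℕ} {u : ι → V} (hu : KruskalIndep K k u) (hk : 1 ≤ k) (i : ι) :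
    u i ≠ 0 :=
  (hu {i} (by simpa using hk)).ne_zero (by simp)

/-- Reindexing by a permutation and rescaling preserves Kruskal independence. -/
lemma KruskalIndep.rescale {k : ℕ} {u u' : ι → V} (hu : KruskalIndep K k u)
    (σ : Equiv.Perm ι) {c : ι → K} (hc : ∀ i, c i ≠ 0) (h : ∀ i, u' i = c i • u (σ i)) :
    KruskalIndep K k u' := by
  classical
  intro s hs
  have hi := hu (s.map σ.toEmbedding) (by simpa using hs)
  rw [linearIndepOn_finset_iff] at hi ⊢
  intro f hf i his
  have := hi (fun j => f (σ.symm j) * c (σ.symm j)) (by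
    simpa [mul_smul, h] using hf) (σ i) (by simpa using his)
  simpa [hc i] using this

lemma LinearIndepOn.exists_dual_eq_one {u : ι → V} {s : Set ι} (hs : LinearIndepOn K u s)
    {j : ι} (hj : j ∈ s) :
    ∃ f : Module.Dual K V, f (u j) = 1 ∧ ∀ i ∈ s, i ≠ j → f (u i) = 0 := by
  obtain ⟨f, hf, hker⟩ := Submodule.exists_le_ker_of_notMem (hs.notMem_span hj)
  refine ⟨(f (u j))⁻¹ • f, by simp [hf], fun i hi hij => ?_⟩
  have : f (u i) = 0 := hker (Submodule.subset_span ⟨i, ⟨hi, hij⟩, rfl⟩)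
  simp [this]

variable [Fintype ι]

/-- A functional that is `1` at `u p`, vanishes on a prescribed small subfamily, and is nonzero on
few members of a Kruskal independent family. -/
lemma KruskalIndep.exists_dual_card_support_le [DecidableEq K] {k : ℕ} {u : ι → V}
    (hu : KruskalIndep K k u)
    (hk : k ≤ Fintype.card ι) {p : ι} {T : Finset ι} (hp : p ∉ T) (hT : T.card + 1 ≤ k) :
    ∃ f : Module.Dual K V, f (u p) = 1 ∧ (∀ i ∈ T, f (u i) = 0) ∧
      (Finset.univ.filter fun i => f (u i) ≠ 0).card + k ≤ Fintype.card ι + 1 := by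
  classical
  obtain ⟨S, hTS, hSp, hS⟩ := Finset.exists_subsuperset_card_eq (s := T) (t := Finset.univ.erase p)
    (n := k - 1) (Finset.subset_erase.2 ⟨Finset.subset_univ T, hp⟩) (by omega)
    (by rw [Finset.card_erase_of_mem (Finset.mem_univ p), Finset.card_univ]; omega)
  have hpS : p ∉ S := fun h => by simpa using hSp h
  obtain ⟨f, hf, hf0⟩ := (hu (insert p S) (by rw [Finset.card_insert_of_notMem hpS]; omega)
    ).exists_dual_eq_one (j := p) (by simp)
  have hfS : ∀ i ∈ S, f (u i) = 0 := fun i hi =>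
    hf0 i (by simp [hi]) (fun h => hpS (h ▸ hi))
  refine ⟨f, hf, fun i hi => hfS i (hTS hi), ?_⟩
  have hsub : (Finset.univ.filter fun i => f (u i) ≠ 0) ⊆ Sᶜ := fun i hi => by
    simp only [Finset.mem_filter, Finset.mem_univ, true_and] at hi
    exact Finset.mem_compl.2 fun h => hi (hfS i h)
  have := Finset.card_le_card hsub
  have := S.card_le_univ
  rw [Finset.card_compl] at *
  omega

/-- A form of Sylvester's rank inequality: if `∑ i ∈ I, c i • u i ⊗ v i` can be written with
`I'.card` rank-one terms, then `I'.card` is at least `J₁.card + J₂.card - I.card` for all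
`J₁, J₂ ⊆ I` on which `u`, respectively `v`, is linearly independent. -/
lemma card_add_card_le_of_bilinear_eq {u u' : ι → A} {v v' : ι → B} {c c' : ι → K}
    {I I' J₁ J₂ : Finset ι} (hJ₁I : J₁ ⊆ I) (hJ₂I : J₂ ⊆ I)
    (hJ₁ : LinearIndepOn K u J₁) (hJ₂ : LinearIndepOn K v J₂) (hc : ∀ i ∈ I, c i ≠ 0)
    (H : ∀ (f : Module.Dual K A) (g : Module.Dual K B),
      ∑ i ∈ I, c i * f (u i) * g (v i) = ∑ i ∈ I', c' i * f (u' i) * g (v' i)) :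
    J₁.card + J₂.card ≤ I.card + I'.card := by
  classical
  by_contra! hlt
  choose e he1 he0 using fun j : J₁ => hJ₁.exists_dual_eq_one (j := j.1) j.2
  let F : (J₁ → K) →ₗ[K] Module.Dual K A := Fintype.linearCombination K e
  have hF : ∀ a (j : J₁), F a (u j) = a j := fun a j => by
    simp only [F, Fintype.linearCombination_apply, LinearMap.sum_apply, LinearMap.smul_apply,
      smul_eq_mul]
    rw [Finset.sum_eq_single j (fun b _ hb => by
      rw [he0 b j j.2 (fun h => hb (Subtype.ext h.symm)), mul_zero]) (by simp), he1, mul_one]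
  let E : (J₁ → K) →ₗ[K] (I' → K) × ((I \ J₂ : Finset ι) → K) :=
    (LinearMap.pi fun i : I' => (Module.Dual.eval K A (u' i)).comp F).prod
      (LinearMap.pi fun i : (I \ J₂ : Finset ι) => (Module.Dual.eval K A (u i)).comp F)
  have hE : E.ker ≠ ⊥ := LinearMap.ker_ne_bot_of_finrank_lt (by
    simp only [Module.finrank_prod, Module.finrank_fintype_fun_eq_card, Fintype.card_coe,
      Finset.card_sdiff_of_subset hJ₂I]
    have := Finset.card_le_card hJ₂I
    omega)
  obtain ⟨a, ha, ha0⟩ := Submodule.exists_mem_ne_zero_of_ne_bot hE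
  have hpair := Prod.ext_iff.1 (LinearMap.mem_ker.1 ha)
  have h1 : ∀ i ∈ I', F a (u' i) = 0 := fun i hi => congrFun hpair.1 ⟨i, hi⟩
  have h2 : ∀ i ∈ I, i ∉ J₂ → F a (u i) = 0 := fun i hi hi' =>
    congrFun hpair.2 ⟨i, Finset.mem_sdiff.2 ⟨hi, hi'⟩⟩
  have h3 : ∀ i ∈ J₂, F a (u i) = 0 := by
    intro j hj
    obtain ⟨g, hg1, hg0⟩ := hJ₂.exists_dual_eq_one (j := j) hj
    have := H (F a) g
    rw [Finset.sum_eq_zero (s := I') (fun i hi => by simp [h1 i hi]),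
      Finset.sum_eq_single_of_mem j (hJ₂I hj) (fun i hi hij => ?_), hg1, mul_one] at this
    · exact (mul_eq_zero.1 this).resolve_left (hc j (hJ₂I hj))
    · by_cases hi2 : i ∈ J₂
      · rw [hg0 i hi2 hij, mul_zero]
      · rw [h2 i hi hi2, mul_zero, zero_mul]
  refine ha0 (funext fun j => ?_)
  rw [← hF a j]
  by_cases hj : (j : ι) ∈ J₂
  · exact h3 j hj
  · exact h2 j (hJ₁I j.2) hj

lemma Submodule.notMem_and_sup_span_singleton_eq_iff {L M : Submodule K V} {y : V} (hy : y ∉ L)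
    (hM : L ⊔ K ∙ y = M) (x : V) : x ∉ L ∧ L ⊔ K ∙ x = M ↔ x ∉ L ∧ x ∈ M := by
  refine and_congr_right fun hx => ⟨fun h => ?_, fun h => ?_⟩
  · exact h ▸ Submodule.mem_sup_right (Submodule.mem_span_singleton_self x)
  · have hcov : L ⋖ M := by
      rw [← hM, sup_comm]
      exact Submodule.covBy_span_singleton_sup hy
    refine (hcov.eq_or_eq le_sup_left (sup_le hcov.le ?_)).resolve_left fun h' => hx ?_
    · simpa using h
    · exact h' ▸ Submodule.mem_sup_right (Submodule.mem_span_singleton_self x)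

open Classical in
/-- Inequality for a flat of codimension at least two, given the inequality for the flats that
cover it. -/
lemma card_notMem_le_of_forall_sup {w w' : ι → V} {L : Submodule K V}
    (hL : Module.finrank K L + 2 ≤ Module.finrank K (Submodule.span K (Set.range w')))
    [FiniteDimensional K L]
    (h : ∀ j, w' j ∉ L → (Finset.univ.filter fun i => w i ∉ L ⊔ K ∙ w' j).card ≤
      (Finset.univ.filter fun i => w' i ∉ L ⊔ K ∙ w' j).card) :
    (Finset.univ.filter fun i => w i ∉ L).card ≤ (Finset.univ.filter fun i => w' i ∉ L).card := by
  set P := (Finset.univ.filter fun i => w' i ∉ L).image fun i => L ⊔ K ∙ w' i with hP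
  have key : ∀ (x : ι → V), ∀ M ∈ P,
      ((Finset.univ.filter fun i => x i ∉ L).filter fun i => L ⊔ K ∙ x i = M).card +
        (Finset.univ.filter fun i => x i ∉ M).card = (Finset.univ.filter fun i => x i ∉ L).card := by
    intro x M hM
    obtain ⟨j, hj, rfl⟩ := Finset.mem_image.1 hM
    simp only [Finset.mem_filter, Finset.mem_univ, true_and] at hj
    rw [← Finset.card_filter_add_card_filter_not (s := Finset.univ.filter fun i => x i ∉ L)
      (fun i => x i ∈ L ⊔ K ∙ w' j)]
    simp only [Finset.filter_filter, Submodule.notMem_and_sup_span_singleton_eq_iff hj rfl]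
    congr 2
    ext i
    simp only [Finset.mem_filter, Finset.mem_univ, true_and]
    exact ⟨fun hi => ⟨fun hi' => hi (Submodule.mem_sup_left hi'), hi⟩, fun hi => hi.2⟩
  have hle : ∀ M ∈ P, (Finset.univ.filter fun i => w i ∉ M).card ≤
      (Finset.univ.filter fun i => w' i ∉ M).card := by
    intro M hM
    obtain ⟨j, hj, rfl⟩ := Finset.mem_image.1 hM
    exact h j (by simpa using hj)
  have hN : 2 ≤ P.card := by
    by_contra! hN
    have hlt : ∀ j, w' j ∉ L → Submodule.span K (Set.range w') ≤ L ⊔ K ∙ w' j := by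
      intro j hj
      rw [Submodule.span_le]
      rintro _ ⟨i, rfl⟩
      by_cases hi : w' i ∈ L
      · exact Submodule.mem_sup_left hi
      · have : L ⊔ K ∙ w' i = L ⊔ K ∙ w' j :=
          Finset.card_le_one.1 (by omega : P.card ≤ 1) _
            (Finset.mem_image.2 ⟨i, by simpa using hi, rfl⟩) _
            (Finset.mem_image.2 ⟨j, by simpa using hj, rfl⟩)
        exact this ▸ Submodule.mem_sup_right (Submodule.mem_span_singleton_self _)
    by_cases hex : ∃ j, w' j ∉ L
    · obtain ⟨j, hj⟩ := hex
      have h1 := Submodule.finrank_mono (hlt j hj)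
      have h2 := Submodule.finrank_add_le_finrank_add_finrank L (K ∙ w' j)
      have h3 := finrank_span_singleton (K := K) (v := w' j) (fun h0 => hj (h0 ▸ L.zero_mem))
      omega
    · push Not at hex
      have := Submodule.finrank_mono (R := K) (s := Submodule.span K (Set.range w')) (t := L)
        (Submodule.span_le.2 (by rintro _ ⟨i, rfl⟩; exact hex i))
      omega
  have e1 := Finset.card_eq_sum_card_image (fun i => L ⊔ K ∙ w' i)
    (Finset.univ.filter fun i => w' i ∉ L)
  have e2 : ∑ M ∈ P, ((Finset.univ.filter fun i => w i ∉ L).filter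
      fun i => L ⊔ K ∙ w i = M).card ≤ (Finset.univ.filter fun i => w i ∉ L).card := by
    rw [Finset.sum_card_fiberwise_eq_card_filter]
    exact Finset.card_filter_le _ _
  have e3 := Finset.sum_congr rfl (key w)
  have e4 := Finset.sum_congr rfl (key w')
  have e5 := Finset.sum_le_sum hle
  rw [Finset.sum_add_distrib, Finset.sum_const, smul_eq_mul] at e3 e4
  rw [← hP] at e1
  by_contra! hlt
  nlinarith

open Classical in
lemma card_notMem_le_of_forall_dual {w w' : ι → V}
    (h : ∀ f : Module.Dual K V,
      (Finset.univ.filter fun i => f (w' i) ≠ 0).card +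
        Module.finrank K (Submodule.span K (Set.range w')) ≤ Fintype.card ι + 1 →
      (Finset.univ.filter fun i => f (w i) ≠ 0).card ≤
        (Finset.univ.filter fun i => f (w' i) ≠ 0).card)
    (n : ℕ) (s : Set ι)
    (hn : Module.finrank K (Submodule.span K (w' '' s)) + n =
      Module.finrank K (Submodule.span K (Set.range w'))) :
    (Finset.univ.filter fun i => w i ∉ Submodule.span K (w' '' s)).card ≤
      (Finset.univ.filter fun i => w' i ∉ Submodule.span K (w' '' s)).card := by
  set W := Submodule.span K (Set.range w') with hW
  have hw'W : ∀ i, w' i ∈ W := fun i => Submodule.subset_span ⟨i, rfl⟩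
  have hcard : Module.finrank K W ≤ Fintype.card ι := finrank_range_le_card w'
  have hwW : ∀ i, w i ∈ W := by
    intro i
    by_contra hi
    obtain ⟨f, hf, hker⟩ := Submodule.exists_le_ker_of_notMem hi
    have h0 : (Finset.univ.filter fun i => f (w' i) ≠ 0).card = 0 := by
      simpa using fun i => hker (hw'W i)
    have := h f (by omega)
    rw [h0, Nat.le_zero, Finset.card_eq_zero, Finset.filter_eq_empty_iff] at this
    exact this (Finset.mem_univ i) hf
  have hsub : ∀ s : Set ι, Submodule.span K (w' '' s) ≤ W := fun s =>
    Submodule.span_mono (Set.image_subset_range _ _)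
  have hfin : FiniteDimensional K W := FiniteDimensional.span_of_finite K (Set.finite_range w')
  have hfins : ∀ s : Set ι, FiniteDimensional K (Submodule.span K (w' '' s)) := fun s =>
    FiniteDimensional.span_of_finite K (Set.toFinite _)
  induction n using Nat.strong_induction_on generalizing s with
  | _ n ih =>
  set L := Submodule.span K (w' '' s) with hL
  match n, hn with
  | 0, hn =>
    have hLW : L = W := Submodule.eq_of_le_of_finrank_le (hsub s) (by omega)
    simp [hLW, hwW]
  | 1, hn =>
    obtain ⟨j, hj⟩ : ∃ j, w' j ∉ L := by
      by_contra! hall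
      have := Submodule.finrank_mono (R := K) (s := W) (t := L)
        (Submodule.span_le.2 (by rintro _ ⟨i, rfl⟩; exact hall i))
      omega
    obtain ⟨f, hf, hker⟩ := Submodule.exists_le_ker_of_notMem hj
    have hLM : L = f.ker ⊓ W := by
      have : FiniteDimensional K (f.ker ⊓ W : Submodule K V) :=
        Submodule.finiteDimensional_of_le inf_le_right
      refine Submodule.eq_of_le_of_finrank_le (le_inf hker (hsub s)) ?_
      have : f.ker ⊓ W < W := lt_of_le_of_ne inf_le_right fun he =>
        hf ((inf_eq_right.1 he) (hw'W j))
      have := Submodule.finrank_lt_finrank_of_lt this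
      omega
    have hmem : ∀ x ∈ W, (x ∉ L ↔ f x ≠ 0) := fun x hx => by
      rw [hLM]; simp [hx]
    simp only [hmem _ (hwW _), hmem _ (hw'W _)]
    apply h
    have hspan : L ≤ Submodule.span K
        (((Finset.univ.filter fun i => w' i ∈ L).image w' : Finset V) : Set V) := by
      refine Submodule.span_mono ?_
      rintro _ ⟨i, hi, rfl⟩
      simp only [Finset.coe_image, Finset.coe_filter, Finset.mem_univ, true_and]
      exact ⟨i, Submodule.subset_span ⟨i, hi, rfl⟩, rfl⟩
    have h1 := (Submodule.finrank_mono hspan).trans (finrank_span_finset_le_card _)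
    have h2 := (Finset.card_image_le (s := Finset.univ.filter fun i => w' i ∈ L) (f := w'))
    have h3 := Finset.card_filter_add_card_filter_not (s := (Finset.univ : Finset ι))
      (fun i => w' i ∈ L)
    simp only [hmem _ (hw'W _), Finset.card_univ] at h3
    omega
  | n + 2, hn =>
    refine card_notMem_le_of_forall_sup (by rw [← hW]; omega) fun j hj => ?_
    have hins : L ⊔ K ∙ w' j = Submodule.span K (w' '' insert j s) := by
      rw [Set.image_insert_eq, Submodule.span_insert, sup_comm]
    have hlt : L < L ⊔ K ∙ w' j := by
      rw [sup_comm]; exact (Submodule.covBy_span_singleton_sup hj).lt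
    rw [hins] at hlt ⊢
    have h1 := Submodule.finrank_lt_finrank_of_lt hlt
    have h2 := Submodule.finrank_mono (hsub (insert j s))
    exact ih (Module.finrank K W - Module.finrank K (Submodule.span K (w' '' insert j s)))
      (by omega) (insert j s) (by omega)

open Classical in
/-- Kruskal's permutation lemma. -/
lemma KruskalIndep.exists_perm_of_forall_dual {w w' : ι → V} (hw : KruskalIndep K 2 w)
    (h : ∀ f : Module.Dual K V,
      (Finset.univ.filter fun i => f (w' i) ≠ 0).card +
        Module.finrank K (Submodule.span K (Set.range w')) ≤ Fintype.card ι + 1 →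
      (Finset.univ.filter fun i => f (w i) ≠ 0).card ≤
        (Finset.univ.filter fun i => f (w' i) ≠ 0).card) :
    ∃ (σ : Equiv.Perm ι) (c : ι → K), (∀ i, c i ≠ 0) ∧ ∀ i, w' i = c i • w (σ i) := by
  have hcount : ∀ s : Set ι,
      (Finset.univ.filter fun i => w' i ∈ Submodule.span K (w' '' s)).card ≤
        (Finset.univ.filter fun i => w i ∈ Submodule.span K (w' '' s)).card := by
    intro s
    have hfin : FiniteDimensional K (Submodule.span K (Set.range w')) :=
      FiniteDimensional.span_of_finite K (Set.finite_range w')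
    have h0 := card_notMem_le_of_forall_dual h _ s (Nat.add_sub_cancel'
      (Submodule.finrank_mono (Submodule.span_mono (Set.image_subset_range w' s))))
    have h1 := Finset.card_filter_add_card_filter_not (s := (Finset.univ : Finset ι))
      (fun i => w' i ∈ Submodule.span K (w' '' s))
    have h2 := Finset.card_filter_add_card_filter_not (s := (Finset.univ : Finset ι))
      (fun i => w i ∈ Submodule.span K (w' '' s))
    omega
  have hw0 := hw.ne_zero one_le_two
  have hw'0 : ∀ i, w' i ≠ 0 := by
    intro i hi
    have h0 := hcount ∅
    simp only [Set.image_empty, Submodule.span_empty, Submodule.mem_bot, hw0,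
      Finset.filter_false, Finset.card_empty, Nat.le_zero, Finset.card_eq_zero,
      Finset.filter_eq_empty_iff] at h0
    exact h0 (Finset.mem_univ i) hi
  have hline : ∀ i, (Finset.univ.filter fun j => w' j ∈ K ∙ w' i).card ≤
      (Finset.univ.filter fun j => w j ∈ K ∙ w' i).card := fun i => by
    simpa using hcount {i}
  have hex : ∀ i, ∃ j, ∃ c : K, c ≠ 0 ∧ w' i = c • w j := by
    intro i
    have hpos : 0 < (Finset.univ.filter fun j => w' j ∈ K ∙ w' i).card :=
      Finset.card_pos.2 ⟨i, by simp⟩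
    obtain ⟨j, hj⟩ := Finset.card_pos.1 (hpos.trans_le (hline i))
    obtain ⟨c, hc⟩ := Submodule.mem_span_singleton.1 (Finset.mem_filter.1 hj).2
    have hc0 : c ≠ 0 := by
      rintro rfl
      exact hw0 j (by simpa using hc.symm)
    exact ⟨j, c⁻¹, inv_ne_zero hc0, by rw [← hc, inv_smul_smul₀ hc0]⟩
  choose σ c hc hσ using hex
  have hinj : Function.Injective σ := by
    intro i i' hii
    by_contra hne
    have hi' : w' i' ∈ K ∙ w' i := by
      rw [hσ i', hσ i, ← hii, Submodule.span_singleton_smul_eq (hc i).isUnit]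
      exact Submodule.smul_mem _ _ (Submodule.mem_span_singleton_self _)
    have h2 : 1 < (Finset.univ.filter fun j => w' j ∈ K ∙ w' i).card :=
      Finset.one_lt_card.2 ⟨i, by simp, i', by simpa using hi', hne⟩
    obtain ⟨a, ha, b, hb, hab⟩ := Finset.one_lt_card.1 (h2.trans_le (hline i))
    simp only [Finset.mem_filter, Finset.mem_univ, true_and] at ha hb
    obtain ⟨x, hx⟩ := Submodule.mem_span_singleton.1 ha
    obtain ⟨y, hy⟩ := Submodule.mem_span_singleton.1 hb
    have hli := hw {a, b} (Finset.card_le_two)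
    rw [Finset.coe_pair, LinearIndepOn.pair_iff _ hab] at hli
    have hx0 := (hli y (-x) (by rw [← hx, ← hy, smul_smul, smul_smul, mul_comm]; simp)).2
    exact hw0 a (by rw [← hx, neg_eq_zero.1 hx0, zero_smul])
  exact ⟨Equiv.ofBijective σ (Finite.injective_iff_bijective.1 hinj), c, hc, hσ⟩

open Classical in
lemma card_support_le_of_trilinear_eq {kA kB kC : ℕ} {u u' : ι → A} {v v' : ι → B}
    {w w' : ι → C} (hu : KruskalIndep K kA u) (hv : KruskalIndep K kB v)
    (hkA : kA ≤ Fintype.card ι) (hkB : kB ≤ Fintype.card ι)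
    (hk : 2 * Fintype.card ι + 2 ≤ kA + kB + kC)
    (H : ∀ (f : Module.Dual K A) (g : Module.Dual K B) (h : Module.Dual K C),
      ∑ i, f (u i) * g (v i) * h (w i) = ∑ i, f (u' i) * g (v' i) * h (w' i))
    (h : Module.Dual K C)
    (hh : (Finset.univ.filter fun i => h (w' i) ≠ 0).card + kC ≤ Fintype.card ι + 1) :
    (Finset.univ.filter fun i => h (w i) ≠ 0).card ≤
      (Finset.univ.filter fun i => h (w' i) ≠ 0).card := by
  set I := Finset.univ.filter fun i => h (w i) ≠ 0 with hI
  set I' := Finset.univ.filter fun i => h (w' i) ≠ 0 with hI'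
  obtain ⟨J₁, hJ₁I, hJ₁⟩ := Finset.exists_subset_card_eq (min_le_left I.card kA)
  obtain ⟨J₂, hJ₂I, hJ₂⟩ := Finset.exists_subset_card_eq (min_le_left I.card kB)
  have hsum : ∀ (f : Module.Dual K A) (g : Module.Dual K B) (x : ι → A) (y : ι → B) (z : ι → C),
      ∑ i ∈ Finset.univ.filter (fun i => h (z i) ≠ 0), h (z i) * f (x i) * g (y i) =
        ∑ i, f (x i) * g (y i) * h (z i) := by
    intro f g x y z
    rw [Finset.sum_filter]
    refine Finset.sum_congr rfl fun i _ => ?_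
    split_ifs with hi
    · ring
    · rw [not_not.1 hi, mul_zero]
  have := card_add_card_le_of_bilinear_eq (c := fun i => h (w i)) (c' := fun i => h (w' i))
    (u' := u') (v' := v') (I' := I') hJ₁I hJ₂I
    (hu J₁ (by omega)) (hv J₂ (by omega)) (fun i hi => (Finset.mem_filter.1 hi).2)
    (fun f g => by rw [hsum, hsum, H])
  have := I.card_le_univ
  omega

/-- Under Kruskal's inequality the third factors agree up to permutation and scaling. -/
lemma exists_perm_of_trilinear_eq {kA kB kC : ℕ} {u u' : ι → A} {v v' : ι → B}
    {w w' : ι → C} (hu : KruskalIndep K kA u) (hv : KruskalIndep K kB v)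
    (hw : KruskalIndep K kC w) (hkA : kA ≤ Fintype.card ι) (hkB : kB ≤ Fintype.card ι)
    (hkC : kC ≤ Fintype.card ι) (hk : 2 * Fintype.card ι + 2 ≤ kA + kB + kC)
    (H : ∀ (f : Module.Dual K A) (g : Module.Dual K B) (h : Module.Dual K C),
      ∑ i, f (u i) * g (v i) * h (w i) = ∑ i, f (u' i) * g (v' i) * h (w' i)) :
    ∃ (σ : Equiv.Perm ι) (c : ι → K), (∀ i, c i ≠ 0) ∧ ∀ i, w' i = c i • w (σ i) := by
  classical
  have hsupp := card_support_le_of_trilinear_eq hu hv hkA hkB hk H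
  have hspan : Submodule.span K (Set.range w) ≤ Submodule.span K (Set.range w') := by
    rw [Submodule.span_le]
    rintro _ ⟨i, rfl⟩
    by_contra hi
    obtain ⟨h, hh, hker⟩ := Submodule.exists_le_ker_of_notMem hi
    have h0 : (Finset.univ.filter fun i => h (w' i) ≠ 0).card = 0 := by
      simpa using fun i => hker (Submodule.subset_span ⟨i, rfl⟩)
    have := hsupp h (by omega)
    rw [h0, Nat.le_zero, Finset.card_eq_zero, Finset.filter_eq_empty_iff] at this
    exact this (Finset.mem_univ i) hh
  have hrank : kC ≤ Module.finrank K (Submodule.span K (Set.range w')) := by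
    obtain ⟨S, -, hS⟩ := Finset.exists_subset_card_eq (s := (Finset.univ : Finset ι)) hkC
    have hfin : FiniteDimensional K (Submodule.span K (Set.range w')) :=
      FiniteDimensional.span_of_finite K (Set.finite_range w')
    have h1 := finrank_span_eq_card (hw S hS.le)
    have h2 : Submodule.span K (Set.range fun i : (S : Set ι) => w i) ≤
        Submodule.span K (Set.range w') :=
      (Submodule.span_mono (by rintro _ ⟨i, rfl⟩; exact ⟨i, rfl⟩)).trans hspan
    have h3 := Submodule.finrank_mono h2
    simp only [Finset.coe_sort_coe, Fintype.card_coe] at h1 h3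
    omega
  exact KruskalIndep.exists_perm_of_forall_dual (fun s hs => hw s (by omega))
    (fun f hf => hsupp f (by omega))

/-- Under Kruskal's inequality the permutations matching the first and third factors agree. -/
lemma perm_eq_of_trilinear_eq {kA kB kC : ℕ} {u u' : ι → A} {v v' : ι → B}
    {w w' : ι → C} (hu : KruskalIndep K kA u) (hv' : KruskalIndep K kB v')
    (hw : KruskalIndep K kC w) (hkA : kA ≤ Fintype.card ι) (hkB : kB ≤ Fintype.card ι)
    (hkC : kC ≤ Fintype.card ι) (hk : 2 * Fintype.card ι + 2 ≤ kA + kB + kC)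
    (H : ∀ (f : Module.Dual K A) (g : Module.Dual K B) (h : Module.Dual K C),
      ∑ i, f (u i) * g (v i) * h (w i) = ∑ i, f (u' i) * g (v' i) * h (w' i))
    {τ σ : Equiv.Perm ι} {a c : ι → K} (ha : ∀ i, a i ≠ 0) (hc : ∀ i, c i ≠ 0)
    (hu' : ∀ i, u' i = a i • u (τ i)) (hw' : ∀ i, w' i = c i • w (σ i)) : τ = σ := by
  classical
  ext j
  by_contra hne
  obtain ⟨h, hh1, hh0, hcard⟩ := hw.exists_dual_card_support_le hkC (p := σ j) (T := {τ j})
    (by simpa using Ne.symm hne) (by simp; omega)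
  set I := Finset.univ.filter fun i => h (w i) ≠ 0 with hI
  have hτ : h (w (τ j)) = 0 := hh0 _ (by simp)
  obtain ⟨f, hf1, hf0⟩ := (hu (insert (τ j) I) ((Finset.card_insert_le _ _).trans
    (by omega))).exists_dual_eq_one (j := τ j) (by simp)
  have hI' : (Finset.univ.filter fun i => h (w' i) ≠ 0) = I.map σ.symm.toEmbedding := by
    ext i
    simp [hI, hw', hc, Finset.mem_map_equiv]
  obtain ⟨g, hg1, hg0⟩ := (hv' (Finset.univ.filter fun i => h (w' i) ≠ 0)
    (by rw [hI', Finset.card_map]; omega)).exists_dual_eq_one (j := j) (by simp [hw', hc, hh1])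
  have hH := H f g h
  rw [Finset.sum_eq_zero, Finset.sum_eq_single j] at hH
  · simp [hu', hw', hf1, hg1, hh1, ha, hc] at hH
  · intro i _ hij
    by_cases hi : h (w' i) = 0
    · rw [hi, mul_zero]
    · rw [hg0 i (by simpa using hi) hij, mul_zero, zero_mul]
  · simp
  · intro i _
    by_cases hi : h (w i) = 0
    · rw [hi, mul_zero]
    · rw [hf0 i (by simp [hI, hi]) (fun h' => hi (h' ▸ hτ)), zero_mul, zero_mul]

/-- Kruskal's theorem in terms of trilinear pairings. -/
lemma exists_perm_rescale_of_trilinear_eq {kA kB kC : ℕ} {u u' : ι → A} {v v' : ι → B}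
    {w w' : ι → C} (hu : KruskalIndep K kA u) (hv : KruskalIndep K kB v)
    (hw : KruskalIndep K kC w) (hkA : kA ≤ Fintype.card ι) (hkB : kB ≤ Fintype.card ι)
    (hkC : kC ≤ Fintype.card ι) (hk : 2 * Fintype.card ι + 2 ≤ kA + kB + kC)
    (H : ∀ (f : Module.Dual K A) (g : Module.Dual K B) (h : Module.Dual K C),
      ∑ i, f (u i) * g (v i) * h (w i) = ∑ i, f (u' i) * g (v' i) * h (w' i)) :
    ∃ (σ : Equiv.Perm ι) (a b c : ι → K),
      (∀ i, a i ≠ 0) ∧ (∀ i, b i ≠ 0) ∧ (∀ i, c i ≠ 0) ∧ (∀ i, a i * b i * c i = 1) ∧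
      (∀ i, u' i = a i • u (σ i)) ∧ (∀ i, v' i = b i • v (σ i)) ∧
      (∀ i, w' i = c i • w (σ i)) := by
  classical
  have Hvu : ∀ (g : Module.Dual K B) (f : Module.Dual K A) (h : Module.Dual K C),
      ∑ i, g (v i) * f (u i) * h (w i) = ∑ i, g (v' i) * f (u' i) * h (w' i) := fun g f h => by
    simpa only [mul_comm (g _)] using H f g h
  have Hvw : ∀ (g : Module.Dual K B) (h : Module.Dual K C) (f : Module.Dual K A),
      ∑ i, g (v i) * h (w i) * f (u i) = ∑ i, g (v' i) * h (w' i) * f (u' i) := fun g h f => by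
    simpa only [mul_comm (f _), mul_right_comm, mul_assoc] using Hvu g f h
  have Huw : ∀ (f : Module.Dual K A) (h : Module.Dual K C) (g : Module.Dual K B),
      ∑ i, f (u i) * h (w i) * g (v i) = ∑ i, f (u' i) * h (w' i) * g (v' i) := fun f h g => by
    simpa only [mul_right_comm] using H f g h
  obtain ⟨σ, c, hc, hw'⟩ := exists_perm_of_trilinear_eq hu hv hw hkA hkB hkC hk H
  obtain ⟨τ, a, ha, hu'⟩ := exists_perm_of_trilinear_eq hv hw hu hkB hkC hkA (by omega) Hvw
  obtain ⟨ρ, b, hb, hv'⟩ := exists_perm_of_trilinear_eq hu hw hv hkA hkC hkB (by omega) Huw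
  obtain rfl : τ = σ := perm_eq_of_trilinear_eq hu (hv.rescale ρ hb hv') hw hkA hkB hkC hk H
    ha hc hu' hw'
  obtain rfl : ρ = τ := perm_eq_of_trilinear_eq hv (hu.rescale τ ha hu') hw hkB hkA hkC
    (by omega) Hvu hb hc hv' hw'
  refine ⟨ρ, a, b, c, ha, hb, hc, fun j => ?_, hu', hv', hw'⟩
  obtain ⟨h, hh1, -, hcard⟩ := hw.exists_dual_card_support_le hkC (p := ρ j) (T := ∅)
    (by simp) (by simp; omega)
  obtain ⟨f, hf1, hf0⟩ := (hu (Finset.univ.filter fun i => h (w i) ≠ 0)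
    (by omega)).exists_dual_eq_one (j := ρ j) (by simp [hh1])
  obtain ⟨g, hg1, -⟩ := (hv {ρ j} (by simp; omega)).exists_dual_eq_one (j := ρ j) (by simp)
  have hz : ∀ i, i ≠ ρ j → f (u i) * g (v i) * h (w i) = 0 := by
    intro i hi
    by_cases hi' : h (w i) = 0
    · rw [hi', mul_zero]
    · rw [hf0 i (by simpa using hi') hi, zero_mul, zero_mul]
  have hH := H f g h
  rw [Finset.sum_eq_single (ρ j) (fun i _ hi => hz i hi) (by simp),
    Finset.sum_eq_single j (fun i _ hi => ?_) (by simp)] at hH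
  · simpa [hu', hv', hw', hf1, hg1, hh1] using hH.symm
  · have := hz (ρ i) (by simpa using hi)
    simp only [hu', hv', hw', map_smul, smul_eq_mul]
    linear_combination (a i * b i * c i) * this

end Field

lemma kruskalRank_spec {V : Type*} [AddCommGroup V] [Module ℂ V] {r : ℕ} (u : Fin r → V) :
    kruskalRank u ≤ r ∧ KruskalIndep ℂ (kruskalRank u) u := by
  have hmem : kruskalRank u ∈ {k | k ≤ r ∧ ∀ s : Finset (Fin r), s.card = k →
      LinearIndependent ℂ (fun i : {x // x ∈ s} => u i)} := by
    refine Nat.sSup_mem ⟨0, Nat.zero_le r, fun s hs => ?_⟩ ⟨r, fun k hk => hk.1⟩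
    obtain rfl := Finset.card_eq_zero.1 hs
    exact linearIndependent_empty_type
  refine ⟨hmem.1, fun s hs => ?_⟩
  obtain ⟨t, hst, -, ht⟩ := Finset.exists_subsuperset_card_eq (Finset.subset_univ s) hs
    (by simpa using hmem.1)
  exact LinearIndepOn.mono (t := (s : Set (Fin r))) (s := (t : Set (Fin r))) (hmem.2 t ht)
    (by exact_mod_cast hst)

/-- Kruskal's theorem, uniqueness statement: if `T = ∑ uᵢ ⊗ vᵢ ⊗ wᵢ` with `r` terms and
`2r ≤ k_A + k_B + k_C − 2`, then the expression is essentially unique: any other length-`r`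
expression differs only by a permutation of the summands and rescalings by scalars whose
product is `1`. -/
theorem kruskal_uniqueness {A B C : Type*} [AddCommGroup A] [Module ℂ A]
    [AddCommGroup B] [Module ℂ B] [AddCommGroup C] [Module ℂ C]
    [FiniteDimensional ℂ A] [FiniteDimensional ℂ B] [FiniteDimensional ℂ C]
    {r : ℕ} (u : Fin r → A) (v : Fin r → B) (w : Fin r → C)
    (T : (A ⊗[ℂ] B) ⊗[ℂ] C)
    (hT : T = ∑ i, (u i ⊗ₜ[ℂ] v i) ⊗ₜ[ℂ] w i)
    (hk : 2 * r + 2 ≤ kruskalRank u + kruskalRank v + kruskalRank w) :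
    ∀ (u' : Fin r → A) (v' : Fin r → B) (w' : Fin r → C),
      T = ∑ i, (u' i ⊗ₜ[ℂ] v' i) ⊗ₜ[ℂ] w' i →
      ∃ (σ : Equiv.Perm (Fin r)) (lam mu nu : Fin r → ℂ),
        (∀ i, lam i ≠ 0) ∧ (∀ i, mu i ≠ 0) ∧ (∀ i, nu i ≠ 0) ∧
        (∀ i, lam i * mu i * nu i = 1) ∧
        (∀ i, u' i = lam i • u (σ i)) ∧
        (∀ i, v' i = mu i • v (σ i)) ∧
        (∀ i, w' i = nu i • w (σ i)) := by
  intro u' v' w' hT'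
  obtain ⟨hkA, hu⟩ := kruskalRank_spec u
  obtain ⟨hkB, hv⟩ := kruskalRank_spec v
  obtain ⟨hkC, hw⟩ := kruskalRank_spec w
  refine exists_perm_rescale_of_trilinear_eq hu hv hw (by simpa using hkA) (by simpa using hkB)
    (by simpa using hkC) (by simpa using hk) fun f g h => ?_
  simpa using congrArg
    (LinearMap.mul' ℂ ℂ ∘ₗ TensorProduct.map (LinearMap.mul' ℂ ℂ ∘ₗ TensorProduct.map f g) h)
    (hT.symm.trans hT')
end

section
/- Let n > 2 and let A_1, ..., A_n be finite-dimensional complex vector spaces. Let T ∈ A_1⊗⋯⊗A_n have tensor rank r. Suppose there are subspaces A'_j ⊆ A_j, with at least one inclusion proper, such that T lies in the subspace A'_1⊗⋯⊗A'_n of A_1⊗⋯⊗A_n. Then any expression T = ∑_{i=1}^ρ u^1_i⊗⋯⊗u^n_i in which some vector u^s_j does not lie in A'_s must have ρ > r. -/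
open TensorProduct

/-- Tensor rank in an `n`-fold tensor product: the smallest `m` such that the tensor is
a sum of `m` simple tensors. -/
noncomputable def tensorRankPi {n : ℕ} {A : Fin n → Type*} [∀ j, AddCommGroup (A j)]
    [∀ j, Module ℂ (A j)] (T : ⨂[ℂ] j, A j) : ℕ :=
  sInf {m | ∃ a : Fin m → (Π j, A j), T = ∑ i, ⨂ₜ[ℂ] j, a i j}

/-- A projection of `V` that fixes a subspace pointwise and kills a given vector outside it. -/
theorem exists_linearMap_apply_eq_zero_of_notMem {K V : Type*} [Field K] [AddCommGroup V]
    [Module K V] (W : Submodule K V) {v : V} (hv : v ∉ W) :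
    ∃ P : V →ₗ[K] V, P v = 0 ∧ P ∘ₗ W.subtype = W.subtype := by
  obtain ⟨φ, hφ, hW⟩ := Submodule.exists_le_ker_of_notMem hv
  refine ⟨LinearMap.id - (φ v)⁻¹ • φ.smulRight v, ?_, ?_⟩
  · simp [smul_smul, hφ]
  · ext ⟨w, hw⟩
    simp [LinearMap.mem_ker.1 (hW hw)]

/-- If `T ∈ A₁ ⊗ ⋯ ⊗ Aₙ` (with `n > 2`) has tensor rank `r` and lies in the subspace
`A'₁ ⊗ ⋯ ⊗ A'ₙ` (i.e. in the image of the canonical map from the tensor product of the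
subspaces `A'ⱼ ⊆ Aⱼ`), with at least one inclusion proper, then any expression
`T = ∑_{i=1}^ρ u¹ᵢ ⊗ ⋯ ⊗ uⁿᵢ` in which some vector `uˢⱼ` lies outside `A'ₛ`
has `ρ > r`. -/
theorem rank_expression_outside_subspace {n : ℕ} (hn : n > 2)
    {A : Fin n → Type*} [∀ j, AddCommGroup (A j)] [∀ j, Module ℂ (A j)]
    [∀ j, FiniteDimensional ℂ (A j)]
    (A' : ∀ j, Submodule ℂ (A j)) (hproper : ∃ j, A' j ≠ ⊤)
    (T : ⨂[ℂ] j, A j) {r : ℕ} (hr : tensorRankPi T = r)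
    (hTmem : T ∈ LinearMap.range (PiTensorProduct.map fun j => (A' j).subtype))
    {ρ : ℕ} (u : Fin ρ → Π j, A j)
    (hT : T = ∑ i, ⨂ₜ[ℂ] j, u i j)
    (hout : ∃ (i : Fin ρ) (s : Fin n), u i s ∉ A' s) :
    ρ > r := by
  obtain ⟨i, s, his⟩ := hout
  obtain ⟨P, hP, hPW⟩ := exists_linearMap_apply_eq_zero_of_notMem (A' s) his
  let f : ∀ j, A j →ₗ[ℂ] A j := Function.update (fun _ => LinearMap.id) s P
  have hfs : f s = P := Function.update_self ..
  have hf : ∀ j, f j ∘ₗ (A' j).subtype = (A' j).subtype := by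
    intro j
    by_cases h : j = s
    · subst h
      rw [hfs, hPW]
    · simp [f, Function.update_of_ne h]
  have hfix : PiTensorProduct.map f T = T := by
    obtain ⟨t, rfl⟩ := hTmem
    rw [← LinearMap.comp_apply, ← PiTensorProduct.map_comp]
    simp only [hf]
  obtain _ | m := ρ
  · exact i.elim0
  have hsum : T = ∑ k : Fin m, ⨂ₜ[ℂ] j, f j (u (i.succAbove k) j) := by
    have hzero : (⨂ₜ[ℂ] j, f j (u i j)) = 0 :=
      (PiTensorProduct.tprod ℂ).map_coord_zero s (by rw [hfs, hP])
    rw [← hfix, hT, map_sum]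
    simp only [PiTensorProduct.map_tprod]
    rw [Fin.sum_univ_succAbove _ i, hzero, zero_add]
  have hle : tensorRankPi T ≤ m := Nat.sInf_le ⟨fun k j => f j (u (i.succAbove k) j), hsum⟩
  omega
end

section
/- Let B and C be finite-dimensional complex vector spaces and let v_1, ..., v_r ∈ B and w_1, ..., w_r ∈ C be nonzero vectors spanning B and C respectively, with Kruskal ranks k_B ≥ 2 and k_C ≥ 2 satisfying r ≤ k_B + k_C − 2. Let s_0 ≠ t_0 be indices in {1, ..., r}. Then there exist subsets S, T ⊆ {1, ..., r} such that: s_0 ∈ S and t_0 ∈ T; S ∩ T = ∅; #S ≤ r − k_B + 1 and #T ≤ r − k_C + 1; and the spans H_S := span{v_j : j ∉ S} ⊆ B and H_T := span{w_j : j ∉ T} ⊆ C are hyperplanes (subspaces of codimension one) with v_{s_0} ∉ H_S and w_{t_0} ∉ H_T. -/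
open Submodule

/-- The supremum defining the Kruskal rank is attained. -/
theorem kruskalRank_spec_s8 {V : Type*} [AddCommGroup V] [Module ℂ V] {r : ℕ} (u : Fin r → V) :
    kruskalRank u ≤ r ∧ ∀ s : Finset (Fin r), s.card = kruskalRank u →
      LinearIndependent ℂ (fun i : {x // x ∈ s} => u i) := by
  have hne : {k | k ≤ r ∧ ∀ s : Finset (Fin r), s.card = k →
      LinearIndependent ℂ (fun i : {x // x ∈ s} => u i)}.Nonempty := by
    refine ⟨0, Nat.zero_le r, fun s hs => ?_⟩
    obtain rfl := Finset.card_eq_zero.mp hs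
    exact linearIndependent_empty_type
  exact Nat.sSup_mem hne ⟨r, fun k hk => hk.1⟩

theorem kruskalRank_le_s8 {V : Type*} [AddCommGroup V] [Module ℂ V] {r : ℕ} (u : Fin r → V) :
    kruskalRank u ≤ r :=
  (kruskalRank_spec_s8 u).1

theorem linearIndepOn_of_card_le_kruskalRank {V : Type*} [AddCommGroup V] [Module ℂ V]
    {r : ℕ} (u : Fin r → V) {s : Finset (Fin r)} (hs : s.card ≤ kruskalRank u) :
    LinearIndepOn ℂ u (s : Set (Fin r)) := by
  obtain ⟨t, hst, ht⟩ := Finset.exists_superset_card_eq hs (by simpa using kruskalRank_le_s8 u)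
  have h : LinearIndepOn ℂ u (t : Set (Fin r)) := (kruskalRank_spec_s8 u).2 t ht
  exact h.mono (Finset.coe_subset.mpr hst)

theorem kruskalRank_le_finrank {V : Type*} [AddCommGroup V] [Module ℂ V]
    [FiniteDimensional ℂ V] {r : ℕ} (u : Fin r → V) :
    kruskalRank u ≤ Module.finrank ℂ V := by
  obtain ⟨t, -, ht⟩ := Finset.exists_superset_card_eq (s := (∅ : Finset (Fin r)))
    (Nat.zero_le (kruskalRank u)) (by simpa using kruskalRank_le_s8 u)
  simpa [ht] using ((kruskalRank_spec_s8 u).2 t ht).fintype_card_le_finrank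

/-- In a finite spanning family, any subfamily whose span avoids `u a` is contained in the
complement of a set `S` whose complementary vectors span a hyperplane avoiding `u a`. -/
theorem exists_finset_span_compl_hyperplane {K V ι : Type*} [Field K] [AddCommGroup V]
    [Module K V] [FiniteDimensional K V] [Fintype ι] [DecidableEq ι] (u : ι → V)
    (hu : span K (Set.range u) = ⊤) (I : Finset ι) (a : ι)
    (ha : u a ∉ span K (u '' (I : Set ι))) :
    ∃ S : Finset ι, a ∈ S ∧ Disjoint S I ∧
      Module.finrank K (span K (u '' {j | j ∉ S})) + 1 = Module.finrank K V ∧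
      u a ∉ span K (u '' {j | j ∉ S}) ∧ Module.finrank K V + S.card ≤ Fintype.card ι + 1 := by
  obtain ⟨J, hIJ, hJ⟩ := Set.Finite.exists_le_maximal
    (Set.toFinite {J : Finset ι | u a ∉ span K (u '' (J : Set ι))}) ha
  have haJ : u a ∉ span K (u '' (J : Set ι)) := hJ.prop
  have hcompl : {j | j ∉ Jᶜ} = (J : Set ι) := by ext; simp
  have hsup : span K (u '' (J : Set ι)) ⊔ K ∙ u a = ⊤ := by
    rw [eq_top_iff, ← hu, span_le]
    rintro _ ⟨j, rfl⟩
    by_cases hj : u j ∈ span K (u '' (J : Set ι))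
    · exact mem_sup_left hj
    have hins : u a ∈ span K (insert (u j) (u '' (J : Set ι))) := by
      by_contra hn
      have hle : insert j J ≤ J := hJ.le_of_ge
        (by simpa [Set.image_insert_eq] using hn) (Finset.subset_insert j J)
      exact hj (subset_span ⟨j, hle (Finset.mem_insert_self j J), rfl⟩)
    have hex := mem_span_insert_exchange hins haJ
    rwa [span_insert, sup_comm] at hex
  have hne : u a ≠ 0 := fun h => haJ (h ▸ zero_mem _)
  have hdisj : Disjoint (span K (u '' (J : Set ι))) (K ∙ u a) :=
    (disjoint_span_singleton' hne).mpr haJ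
  have hrank := finrank_add_eq_of_isCompl (IsCompl.of_eq hdisj.eq_bot hsup)
  rw [finrank_span_singleton hne] at hrank
  refine ⟨Jᶜ, ?_, ?_, ?_, ?_, ?_⟩
  · exact Finset.mem_compl.mpr fun h => haJ (subset_span ⟨a, h, rfl⟩)
  · exact disjoint_compl_left.mono_right hIJ
  · rwa [hcompl]
  · rwa [hcompl]
  · classical
    have hcard : Module.finrank K (span K (u '' (J : Set ι))) ≤ J.card := by
      rw [← Finset.coe_image]
      exact (finrank_span_finset_le_card _).trans Finset.card_image_le
    have := Finset.card_add_card_compl J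
    omega

/-- Construction of the disjoint index sets `S`, `T` and hyperplanes `H_S`, `H_T` used in
the proof of Kruskal's theorem. -/
theorem exists_disjoint_index_sets {B C : Type*}
    [AddCommGroup B] [Module ℂ B] [AddCommGroup C] [Module ℂ C]
    [FiniteDimensional ℂ B] [FiniteDimensional ℂ C]
    {r : ℕ} (v : Fin r → B) (w : Fin r → C)
    (hv0 : ∀ i, v i ≠ 0) (hw0 : ∀ i, w i ≠ 0)
    (hvspan : Submodule.span ℂ (Set.range v) = ⊤)
    (hwspan : Submodule.span ℂ (Set.range w) = ⊤)
    (hkB : 2 ≤ kruskalRank v) (hkC : 2 ≤ kruskalRank w)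
    (hr : r ≤ kruskalRank v + kruskalRank w - 2)
    (s₀ t₀ : Fin r) (hst : s₀ ≠ t₀) :
    ∃ S T : Finset (Fin r),
      s₀ ∈ S ∧ t₀ ∈ T ∧ S ∩ T = ∅ ∧
      S.card ≤ r - kruskalRank v + 1 ∧ T.card ≤ r - kruskalRank w + 1 ∧
      Module.finrank ℂ (Submodule.span ℂ (v '' {j | j ∉ S})) = Module.finrank ℂ B - 1 ∧
      Module.finrank ℂ (Submodule.span ℂ (w '' {j | j ∉ T})) = Module.finrank ℂ C - 1 ∧
      v s₀ ∉ Submodule.span ℂ (v '' {j | j ∉ S}) ∧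
      w t₀ ∉ Submodule.span ℂ (w '' {j | j ∉ T}) := by
  have hkBr := kruskalRank_le_s8 v
  have hkB' := kruskalRank_le_finrank v
  have hkC' := kruskalRank_le_finrank w
  have hs₀ : v s₀ ∉ span ℂ (v '' (({t₀} : Finset (Fin r)) : Set (Fin r))) := by
    have h := linearIndepOn_of_card_le_kruskalRank v
      (s := insert s₀ {t₀}) (Finset.card_le_two.trans hkB)
    rw [Finset.coe_insert, linearIndepOn_insert (by simpa using hst)] at h
    exact h.2
  obtain ⟨S, hsS, hSd, hSrank, hSmem, hScard⟩ :=
    exists_finset_span_compl_hyperplane v hvspan {t₀} s₀ hs₀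
  rw [Fintype.card_fin] at hScard
  have htS : t₀ ∉ S := Finset.disjoint_singleton_right.mp hSd
  have ht₀ : w t₀ ∉ span ℂ (w '' (S : Set (Fin r))) := by
    have h := linearIndepOn_of_card_le_kruskalRank w (s := insert t₀ S)
      (by rw [Finset.card_insert_of_notMem htS]; omega)
    rw [Finset.coe_insert, linearIndepOn_insert (by simpa using htS)] at h
    exact h.2
  obtain ⟨T, htT, hTd, hTrank, hTmem, hTcard⟩ :=
    exists_finset_span_compl_hyperplane w hwspan S t₀ ht₀
  rw [Fintype.card_fin] at hTcard
  exact ⟨S, T, hsS, htT, Finset.disjoint_iff_inter_eq_empty.mp hTd.symm, by omega, by omega,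
    by omega, by omega, hSmem, hTmem⟩
end

section
/- Let A, B, C be complex vector spaces each of dimension a, and let T ∈ A⊗B⊗C be such that the three flattening (contraction) maps (A⊗B)* → C, (A⊗C)* → B, and (B⊗C)* → A induced by T are all surjective. Then any expression T = ∑_{i=1}^a u_i⊗v_i⊗w_i is essentially unique: for any other expression T = ∑_{i=1}^a ũ_i⊗ṽ_i⊗w̃_i there exist a permutation σ of {1, ..., a} and nonzero scalars λ_i, μ_i, ν_i ∈ ℂ with λ_i μ_i ν_i = 1 such that ũ_i = λ_i u_{σ(i)}, ṽ_i = μ_i v_{σ(i)}, w̃_i = ν_i w_{σ(i)} for all i. -/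
open TensorProduct

variable {A B C : Type*} [AddCommGroup A] [Module ℂ A] [AddCommGroup B] [Module ℂ B]
  [AddCommGroup C] [Module ℂ C]

/-- The flattening `(A ⊗ B)* → C` of a tensor `T ∈ (A ⊗ B) ⊗ C`: a functional `φ` is sent
to the contraction of `T` against `φ` in the first two factors. -/
noncomputable def flattenAB_C (T : (A ⊗[ℂ] B) ⊗[ℂ] C)
    (φ : Module.Dual ℂ (A ⊗[ℂ] B)) : C :=
  TensorProduct.lid ℂ C (LinearMap.rTensor C φ T)

/-- The canonical re-association `(A ⊗ B) ⊗ C ≃ (A ⊗ C) ⊗ B`. -/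
noncomputable def reassocACB : ((A ⊗[ℂ] B) ⊗[ℂ] C) ≃ₗ[ℂ] ((A ⊗[ℂ] C) ⊗[ℂ] B) :=
  (TensorProduct.assoc ℂ A B C).trans
    ((TensorProduct.congr (LinearEquiv.refl ℂ A) (TensorProduct.comm ℂ B C)).trans
      (TensorProduct.assoc ℂ A C B).symm)

/-- The canonical re-association `(A ⊗ B) ⊗ C ≃ (B ⊗ C) ⊗ A`. -/
noncomputable def reassocBCA : ((A ⊗[ℂ] B) ⊗[ℂ] C) ≃ₗ[ℂ] ((B ⊗[ℂ] C) ⊗[ℂ] A) :=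
  (TensorProduct.assoc ℂ A B C).trans (TensorProduct.comm ℂ A (B ⊗[ℂ] C))

/-- If the flattening of `∑ i, (x i ⊗ y i) ⊗ z i` onto the third factor is surjective, then the
vectors `z i` span that factor. -/
theorem top_le_span_of_surjective_flattenAB_C {ι : Type*} [Fintype ι]
    (x : ι → A) (y : ι → B) (z : ι → C)
    (h : Function.Surjective (flattenAB_C (∑ i, (x i ⊗ₜ[ℂ] y i) ⊗ₜ[ℂ] z i))) :
    ⊤ ≤ Submodule.span ℂ (Set.range z) := by
  intro c _
  obtain ⟨φ, rfl⟩ := h c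
  simp only [flattenAB_C, map_sum, LinearMap.rTensor_tmul, TensorProduct.lid_tmul]
  exact Submodule.sum_mem _ fun i _ =>
    Submodule.smul_mem _ _ (Submodule.subset_span (Set.mem_range_self i))

theorem reassocACB_tmul (x : A) (y : B) (z : C) :
    reassocACB ((x ⊗ₜ[ℂ] y) ⊗ₜ[ℂ] z) = (x ⊗ₜ[ℂ] z) ⊗ₜ[ℂ] y := by
  simp [reassocACB]

theorem reassocBCA_tmul (x : A) (y : B) (z : C) :
    reassocBCA ((x ⊗ₜ[ℂ] y) ⊗ₜ[ℂ] z) = (y ⊗ₜ[ℂ] z) ⊗ₜ[ℂ] x := by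
  simp [reassocBCA]

/-- When the three flattenings of a sum of simple tensors are surjective, the vectors occurring in
each of the three factors span that factor. -/
theorem top_le_span_of_surjective_flattenings {ι : Type*} [Fintype ι]
    (T : (A ⊗[ℂ] B) ⊗[ℂ] C) (x : ι → A) (y : ι → B) (z : ι → C)
    (hT : T = ∑ i, (x i ⊗ₜ[ℂ] y i) ⊗ₜ[ℂ] z i)
    (hsC : Function.Surjective (flattenAB_C T))
    (hsB : Function.Surjective (flattenAB_C (reassocACB T)))
    (hsA : Function.Surjective (flattenAB_C (reassocBCA T))) :
    ⊤ ≤ Submodule.span ℂ (Set.range x) ∧ ⊤ ≤ Submodule.span ℂ (Set.range y) ∧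
      ⊤ ≤ Submodule.span ℂ (Set.range z) := by
  subst hT
  simp only [map_sum, reassocACB_tmul, reassocBCA_tmul] at hsB hsA
  exact ⟨top_le_span_of_surjective_flattenAB_C _ _ _ hsA,
    top_le_span_of_surjective_flattenAB_C _ _ _ hsB,
    top_le_span_of_surjective_flattenAB_C _ _ _ hsC⟩

/-- Equal sums of simple tensors have equal contractions against triples of functionals. -/
theorem sum_dual_mul_eq_of_sum_tmul_eq {ι κ : Type*} [Fintype ι] [Fintype κ]
    {x : ι → A} {y : ι → B} {z : ι → C} {x' : κ → A} {y' : κ → B} {z' : κ → C}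
    (h : ∑ i, (x i ⊗ₜ[ℂ] y i) ⊗ₜ[ℂ] z i = ∑ i, (x' i ⊗ₜ[ℂ] y' i) ⊗ₜ[ℂ] z' i)
    (f : Module.Dual ℂ A) (g : Module.Dual ℂ B) (k : Module.Dual ℂ C) :
    ∑ i, f (x i) * g (y i) * k (z i) = ∑ i, f (x' i) * g (y' i) * k (z' i) := by
  simpa using congrArg
    (LinearMap.mul' ℂ ℂ ∘ₗ TensorProduct.map (LinearMap.mul' ℂ ℂ ∘ₗ TensorProduct.map f g) k) h

/-- If `∑ i, x i ⊗ y i ⊗ z i = ∑ i, x' i ⊗ y' i ⊗ z' i` as trilinear contractions, with `x`, `y`, `z'`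
bases, then distinct coordinates of `x' m` and `y' m` have product zero. -/
theorem repr_mul_repr_eq_zero {ι : Type*} [Fintype ι]
    (x : Module.Basis ι ℂ A) (y : Module.Basis ι ℂ B) (z : ι → C)
    (x' : ι → A) (y' : ι → B) (z' : Module.Basis ι ℂ C)
    (h : ∀ (f : Module.Dual ℂ A) (g : Module.Dual ℂ B) (k : Module.Dual ℂ C),
      ∑ i, f (x i) * g (y i) * k (z i) = ∑ i, f (x' i) * g (y' i) * k (z' i))
    (m : ι) {j l : ι} (hjl : j ≠ l) :
    x.repr (x' m) j * y.repr (y' m) l = 0 := by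
  classical
  have := h (x.coord j) (y.coord l) (z'.coord m)
  simp only [Module.Basis.coord_apply, Module.Basis.repr_self, Finsupp.single_apply] at this
  simpa [hjl.symm] using this.symm

/-- A vector with at most one nonzero coordinate is a multiple of the basis vector. -/
theorem eq_repr_smul_of_repr_eq_zero {ι : Type*} [Fintype ι]
    (x : Module.Basis ι ℂ A) (c : A) (s : ι) (h : ∀ j, j ≠ s → x.repr c j = 0) :
    c = x.repr c s • x s := by
  conv_lhs => rw [← x.sum_repr c]
  exact Finset.sum_eq_single s (fun j _ hj => by simp [h j hj]) (by simp)

/-- Two decompositions into triads of bases with the same trilinear contractions agree up to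
permutation and rescaling. -/
theorem exists_perm_smul_of_bases {ι : Type*} [Fintype ι]
    (x x' : Module.Basis ι ℂ A) (y y' : Module.Basis ι ℂ B) (z z' : Module.Basis ι ℂ C)
    (h : ∀ (f : Module.Dual ℂ A) (g : Module.Dual ℂ B) (k : Module.Dual ℂ C),
      ∑ i, f (x i) * g (y i) * k (z i) = ∑ i, f (x' i) * g (y' i) * k (z' i)) :
    ∃ (σ : Equiv.Perm ι) (lam mu nu : ι → ℂ),
      (∀ i, lam i * mu i * nu i = 1) ∧ (∀ i, x' i = lam i • x (σ i)) ∧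
      (∀ i, y' i = mu i • y (σ i)) ∧ (∀ i, z' i = nu i • z (σ i)) := by
  classical
  have hxy m {j l : ι} (hjl : j ≠ l) : x.repr (x' m) j * y.repr (y' m) l = 0 :=
    repr_mul_repr_eq_zero x y z x' y' z' h m hjl
  have hxz m {j l : ι} (hjl : j ≠ l) : x.repr (x' m) j * z.repr (z' m) l = 0 :=
    repr_mul_repr_eq_zero x z y x' z' y'
      (fun f k g => by simpa only [mul_right_comm] using h f g k) m hjl
  have hne m : ∃ s, x.repr (x' m) s ≠ 0 := by
    by_contra! hzero
    exact x'.ne_zero m (x.repr.map_eq_zero_iff.mp (Finsupp.ext hzero))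
  choose σ hσ using hne
  have hy m j (hj : j ≠ σ m) : y.repr (y' m) j = 0 :=
    (mul_eq_zero.mp (hxy m hj.symm)).resolve_left (hσ m)
  have hz m j (hj : j ≠ σ m) : z.repr (z' m) j = 0 :=
    (mul_eq_zero.mp (hxz m hj.symm)).resolve_left (hσ m)
  have hy' m := eq_repr_smul_of_repr_eq_zero y (y' m) (σ m) (hy m)
  have hz' m := eq_repr_smul_of_repr_eq_zero z (z' m) (σ m) (hz m)
  have hyσ m : y.repr (y' m) (σ m) ≠ 0 := fun h0 =>
    y'.ne_zero m (by rw [hy' m, h0, zero_smul])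
  have hx m j (hj : j ≠ σ m) : x.repr (x' m) j = 0 :=
    (mul_eq_zero.mp (hxy m hj)).resolve_right (hyσ m)
  have hx' m := eq_repr_smul_of_repr_eq_zero x (x' m) (σ m) (hx m)
  have hinj : Function.Injective σ := by
    intro m n hmn
    by_contra hne
    have hpair : x.repr (x' n) (σ n) • x' m = x.repr (x' m) (σ m) • x' n := by
      conv_lhs => rw [hx' m]
      conv_rhs => rw [hx' n]
      rw [hmn, smul_comm]
    have := congrArg (fun c => x'.repr c m) hpair
    simp [Ne.symm hne, hσ n] at this
  refine ⟨Equiv.ofBijective σ (Finite.injective_iff_bijective.mp hinj),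
    fun m => x.repr (x' m) (σ m), fun m => y.repr (y' m) (σ m), fun m => z.repr (z' m) (σ m),
    fun m => ?_, hx', hy', hz'⟩
  have key := h (x.coord (σ m)) (y.coord (σ m)) (z.coord (σ m))
  simp only [Module.Basis.coord_apply] at key
  rw [Finset.sum_eq_single (σ m) (fun j _ hj => by simp [hj]) (by simp),
    Finset.sum_eq_single m (fun j _ hj => by simp [hx j (σ m) (hinj.ne hj.symm)]) (by simp)] at key
  simpa using key.symm

/-- If `A, B, C` all have dimension `a` and the three flattenings of `T ∈ A ⊗ B ⊗ C` are
surjective, then any length-`a` expression of `T` as a sum of simple tensors is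
essentially unique. -/
theorem uniqueness_of_full_rank_expressions
    [FiniteDimensional ℂ A] [FiniteDimensional ℂ B] [FiniteDimensional ℂ C]
    {a : ℕ} (ha : Module.finrank ℂ A = a) (hb : Module.finrank ℂ B = a)
    (hc : Module.finrank ℂ C = a)
    (T : (A ⊗[ℂ] B) ⊗[ℂ] C)
    (hsC : Function.Surjective (flattenAB_C T))
    (hsB : Function.Surjective (flattenAB_C (reassocACB T)))
    (hsA : Function.Surjective (flattenAB_C (reassocBCA T)))
    (u u' : Fin a → A) (v v' : Fin a → B) (w w' : Fin a → C)
    (hT : T = ∑ i, (u i ⊗ₜ[ℂ] v i) ⊗ₜ[ℂ] w i)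
    (hT' : T = ∑ i, (u' i ⊗ₜ[ℂ] v' i) ⊗ₜ[ℂ] w' i) :
    ∃ (σ : Equiv.Perm (Fin a)) (lam mu nu : Fin a → ℂ),
      (∀ i, lam i ≠ 0) ∧ (∀ i, mu i ≠ 0) ∧ (∀ i, nu i ≠ 0) ∧
      (∀ i, lam i * mu i * nu i = 1) ∧
      (∀ i, u' i = lam i • u (σ i)) ∧
      (∀ i, v' i = mu i • v (σ i)) ∧
      (∀ i, w' i = nu i • w (σ i)) := by
  obtain ⟨hu, hv, hw⟩ := top_le_span_of_surjective_flattenings T u v w hT hsC hsB hsA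
  obtain ⟨hu', hv', hw'⟩ := top_le_span_of_surjective_flattenings T u' v' w' hT' hsC hsB hsA
  have h := sum_dual_mul_eq_of_sum_tmul_eq (hT.symm.trans hT')
  obtain ⟨σ, lam, mu, nu, h1, hx, hy, hz⟩ := exists_perm_smul_of_bases
    (basisOfTopLeSpanOfCardEqFinrank u hu (by simp [ha]))
    (basisOfTopLeSpanOfCardEqFinrank u' hu' (by simp [ha]))
    (basisOfTopLeSpanOfCardEqFinrank v hv (by simp [hb]))
    (basisOfTopLeSpanOfCardEqFinrank v' hv' (by simp [hb]))
    (basisOfTopLeSpanOfCardEqFinrank w hw (by simp [hc]))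
    (basisOfTopLeSpanOfCardEqFinrank w' hw' (by simp [hc]))
    (by simpa only [coe_basisOfTopLeSpanOfCardEqFinrank] using h)
  simp only [coe_basisOfTopLeSpanOfCardEqFinrank] at hx hy hz
  refine ⟨σ, lam, mu, nu, fun i h0 => ?_, fun i h0 => ?_, fun i h0 => ?_, h1, hx, hy, hz⟩ <;>
    simpa [h0] using h1 i
end
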